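/- Let m ≥ 1 and let a, b : Fin m → ℝ be probability vectors with a i > 0 and b i > 0 for all i. Suppose that for every weight vector w : Fin m → ℝ with w i > 0 for all i, the set of maximizers of i ↦ w i · a i equals the set of maximizers of i ↦ w i · b i (i.e., {i : ∀ j, w j · a j ≤ w i · a i} = {i : ∀ j, w j · b j ≤ w i · b i}). Then a = b. -/

import Mathlib

/-- If two positive probability vectors have the same set of maximizers after reweighting
by every positive weight vector, then they are equal: top-label calibration under all
possible changing priors forces complete calibration. -/
theorem top_label_calibration_all_priors_implies_complete
    (m : ℕ) (hm : 1 ≤ m) (a b : Fin m → ℝ)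
    (ha0 : ∀ i, 0 < a i) (ha1 : ∑ i, a i = 1)
    (hb0 : ∀ i, 0 < b i) (hb1 : ∑ i, b i = 1)
    (hmax : ∀ w : Fin m → ℝ, (∀ i, 0 < w i) →
      {i : Fin m | ∀ j, w j * a j ≤ w i * a i} = {i : Fin m | ∀ j, w j * b j ≤ w i * b i}) :
    a = b := by
  have hw := hmax (fun i => (a i)⁻¹) (fun i => inv_pos.mpr (ha0 i))
  have key : ∀ i j, (a j)⁻¹ * b j ≤ (a i)⁻¹ * b i := by
    intro i
    have hi : i ∈ {i : Fin m | ∀ j, (a j)⁻¹ * a j ≤ (a i)⁻¹ * a i} := by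
      intro j
      rw [inv_mul_cancel₀ (ha0 i).ne', inv_mul_cancel₀ (ha0 j).ne']
    rw [hw] at hi
    exact hi
  funext i
  have hb : ∀ j, b j = ((a i)⁻¹ * b i) * a j := by
    intro j
    rw [← le_antisymm (key i j) (key j i)]
    have := (ha0 j).ne'
    field_simp
  have hs : ∑ j, b j = ((a i)⁻¹ * b i) * ∑ j, a j := by
    rw [Finset.mul_sum]
    exact Finset.sum_congr rfl (fun j _ => hb j)
  rw [ha1, hb1, mul_one] at hs
  have := hb i
  rw [← hs, one_mul] at this
  exact this.symm
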